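/- Let c>0 and let v,w be smooth functions on (0,∞)×ℝ³. Then for every (t,x) with x≠0, writing r=|x| and ω=x/r, Q_0(v,w;c)(t,x) = ½·{ (D_{+,c}v)(D_{−,c}w) + (D_{−,c}v)(D_{+,c}w) }(t,x) + (c²/r)·Σ_{j≠k} ω_k·(∂_j v)(Ω_{jk}w)(t,x), where the sum runs over ordered pairs (j,k) with j,k∈{1,2,3}, j≠k, and Ω_{jk}=−Ω_{kj} for j>k. -/

import Mathlib

noncomputable section

namespace PaperKatayama

/-- Euclidean 3-space. -/
abbrev E3 := EuclideanSpace ℝ (Fin 3)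

/-- Space-time functions. -/
abbrev Fn := ℝ → E3 → ℝ

/-- Functions of the space variable alone. -/
abbrev SFn := E3 → ℝ

/-- The Japanese bracket `⟨a⟩ = √(1+a²)`. -/
def jb (a : ℝ) : ℝ := Real.sqrt (1 + a ^ 2)

/-- Time derivative `∂_t`. -/
def pt (f : Fn) : Fn := fun t x => deriv (fun s => f s x) t

/-- Spatial derivative `∂_j` (j = 1,2,3, here indexed by `Fin 3`). -/
def pd (j : Fin 3) (f : Fn) : Fn :=
  fun t x => fderiv ℝ (f t) x (EuclideanSpace.single j 1)

/-- `∂_a` for `a ∈ {0,1,2,3}`, with `∂_0 = ∂_t`. -/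
def pda (a : Fin 4) : Fn → Fn := Fin.cases pt (fun j => pd j) a

/-- Rotation field `Ω_{jk} = x_j ∂_k − x_k ∂_j`, extended antisymmetrically
(so `rotA k j = − rotA j k`, and `rotA j j = 0`). -/
def rotA (j k : Fin 3) (f : Fn) : Fn :=
  fun t x => x j * pd k f t x - x k * pd j f t x

/-- Radial derivative `∂_r = Σ_j (x_j/r) ∂_j`. -/
def pr (f : Fn) : Fn := fun t x => ∑ j, (x j / ‖x‖) * pd j f t x

/-- `D_{+,c} = ∂_t + c ∂_r`. -/
def Dp (c : ℝ) (f : Fn) : Fn := fun t x => pt f t x + c * pr f t x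

/-- `D_{−,c} = ∂_t − c ∂_r`. -/
def Dm (c : ℝ) (f : Fn) : Fn := fun t x => pt f t x - c * pr f t x

/-- The seven fields `Z = {∂_t, ∂_1, ∂_2, ∂_3, Ω_{12}, Ω_{13}, Ω_{23}}`. -/
def Zop : Fin 7 → Fn → Fn :=
  ![pt, pd 0, pd 1, pd 2, rotA 0 1, rotA 0 2, rotA 1 2]

/-- `Z^α = Z_1^{α_1} ⋯ Z_7^{α_7}`. -/
def Zpow (α : Fin 7 → ℕ) (f : Fn) : Fn :=
  (Zop 0)^[α 0] <| (Zop 1)^[α 1] <| (Zop 2)^[α 2] <| (Zop 3)^[α 3] <|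
    (Zop 4)^[α 4] <| (Zop 5)^[α 5] <| (Zop 6)^[α 6] f

/-- Multi-indices `α` (for the seven fields) with `|α| ≤ s`. -/
def multiIdx (s : ℕ) : Finset (Fin 7 → ℕ) :=
  (Fintype.piFinset fun _ => Finset.range (s + 1)).filter fun α => ∑ i, α i ≤ s

/-- `|v(t,x)|_s = Σ_{|α| ≤ s} |Z^α v(t,x)|`. -/
def vnorm (s : ℕ) (f : Fn) (t : ℝ) (x : E3) : ℝ :=
  ∑ α ∈ multiIdx s, |Zpow α f t x|

/-- Smoothness of a space-time function. -/
def Smooth (f : Fn) : Prop := ContDiff ℝ (⊤ : ℕ∞) (fun p : ℝ × E3 => f p.1 p.2)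

/-- `u` is a smooth solution of `∂_t²u − c²Δu = G` on `(0,∞)×ℝ³`
with zero initial data. -/
def IsWaveSol (c : ℝ) (G u : Fn) : Prop :=
  Smooth u ∧
    (∀ t x, 0 < t → pt (pt u) t x - c ^ 2 * ∑ j, pd j (pd j u) t x = G t x) ∧
    (∀ x, u 0 x = 0) ∧ (∀ x, pt u 0 x = 0)

/-- `u` is a smooth solution of the free wave equation `∂_t²u − c²Δu = 0`
on `(0,∞)×ℝ³` with initial data `φ, ψ`. -/
def IsFreeWaveSol (c : ℝ) (φ ψ : SFn) (u : Fn) : Prop :=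
  Smooth u ∧
    (∀ t x, 0 < t → pt (pt u) t x - c ^ 2 * ∑ j, pd j (pd j u) t x = 0) ∧
    (∀ x, u 0 x = φ x) ∧ (∀ x, pt u 0 x = ψ x)

/-- Extension of the speeds `c_1, …, c_N` by `c_0 = 0`. -/
def cs0 {N : ℕ} (cs : Fin N → ℝ) : Fin (N + 1) → ℝ := Fin.cases 0 cs

/-- The weight `w(t,r) = min_{0 ≤ j ≤ N} ⟨c_j t − r⟩` (with `c_0 = 0`). -/
def wgt {N : ℕ} (cs : Fin N → ℝ) (t r : ℝ) : ℝ :=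
  Finset.univ.inf' Finset.univ_nonempty fun j : Fin (N + 1) => jb (cs0 cs j * t - r)

/-- The weighted sup `A_{ρ,μ,s}[G;c](t,x)` over the backward cone `Λ_c(t,x)`. -/
def Afun (ρ μ : ℝ) (s : ℕ) (G : Fn) (c : ℝ) {N : ℕ} (cs : Fin N → ℝ)
    (t : ℝ) (x : E3) : ℝ :=
  sSup {a : ℝ | ∃ τ : ℝ, ∃ y : E3, 0 ≤ τ ∧ τ ≤ t ∧ ‖y - x‖ ≤ c * (t - τ) ∧
    a = ‖y‖ * jb (τ + ‖y‖) ^ ρ * wgt cs τ ‖y‖ ^ (1 + μ) * vnorm s G τ y}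

/-- Spatial derivative of a function of `x` alone. -/
def sd (j : Fin 3) (φ : SFn) : SFn :=
  fun x => fderiv ℝ φ x (EuclideanSpace.single j 1)

/-- Spatial rotation field for functions of `x` alone. -/
def srot (j k : Fin 3) (φ : SFn) : SFn :=
  fun x => x j * sd k φ x - x k * sd j φ x

/-- The six spatial fields `{∂_1, ∂_2, ∂_3, Ω_{12}, Ω_{13}, Ω_{23}}`. -/
def Sop : Fin 6 → SFn → SFn :=
  ![sd 0, sd 1, sd 2, srot 0 1, srot 0 2, srot 1 2]

/-- `Z^α` for the spatial fields. -/
def Spow (α : Fin 6 → ℕ) (φ : SFn) : SFn :=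
  (Sop 0)^[α 0] <| (Sop 1)^[α 1] <| (Sop 2)^[α 2] <| (Sop 3)^[α 3] <|
    (Sop 4)^[α 4] <| (Sop 5)^[α 5] φ

/-- Spatial multi-indices with `|α| ≤ s`. -/
def smultiIdx (s : ℕ) : Finset (Fin 6 → ℕ) :=
  (Fintype.piFinset fun _ => Finset.range (s + 1)).filter fun α => ∑ i, α i ≤ s

/-- `|φ(x)|_s` for a function of `x` alone. -/
def snorm (s : ℕ) (φ : SFn) (x : E3) : ℝ :=
  ∑ α ∈ smultiIdx s, |Spow α φ x|

/-- The weighted sup `B_{ρ,s}[φ,ψ;c](t,x)`. -/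
def Bfun (ρ : ℝ) (s : ℕ) (φ ψ : SFn) (c t : ℝ) (x : E3) : ℝ :=
  sSup {b : ℝ | ∃ y : E3, ‖y - x‖ ≤ c * t ∧
    b = jb ‖y‖ ^ ρ * (snorm (s + 1) φ y + snorm s ψ y)}

/-- `Φ_ρ(t,r)`. -/
def Phi (ρ t r : ℝ) : ℝ :=
  if ρ = 0 then Real.log (2 + jb (t + r) / jb (t - r)) else jb (t - r) ^ (-ρ)

/-- `Ψ_ρ(t)`. -/
def Psi (ρ t : ℝ) : ℝ := if ρ = 0 then Real.log (2 + t) else 1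

/-- The null form `Q_0(v,w;c) = (∂_t v)(∂_t w) − c²(∇v)·(∇w)`. -/
def Q0f (c : ℝ) (v w : Fn) : Fn :=
  fun t x => pt v t x * pt w t x - c ^ 2 * ∑ j, pd j v t x * pd j w t x

/-- The null form `Q_{ab}(v,w) = (∂_a v)(∂_b w) − (∂_b v)(∂_a w)`. -/
def Qab (a b : Fin 4) (v w : Fn) : Fn :=
  fun t x => pda a v t x * pda b w t x - pda b v t x * pda a w t x

/-- Lorentz boost `L_{c,j} = (x_j/c)∂_t + c t ∂_j`. -/
def Lb (c : ℝ) (j : Fin 3) (f : Fn) : Fn :=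
  fun t x => (x j / c) * pt f t x + c * t * pd j f t x

/-- Scaling field `S = t ∂_t + x·∇_x`. -/
def Sc (f : Fn) : Fn := fun t x => t * pt f t x + ∑ j, x j * pd j f t x

/-- `v(t,r,ω) = r u(t, rω)`. -/
def Vrad (u : Fn) (ω : E3) (t r : ℝ) : ℝ := r * u t (r • ω)

/-- `(∂_t + ∂_r) v` in the variables `(t,r)` for fixed `ω`. -/
def DpV (u : Fn) (ω : E3) (t r : ℝ) : ℝ :=
  deriv (fun s => Vrad u ω s r) t + deriv (fun ρ' => Vrad u ω t ρ') r

/-- Cross product in ℝ³. -/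
def cross3 (a b : Fin 3 → ℝ) : Fin 3 → ℝ :=
  ![a 1 * b 2 - a 2 * b 1, a 2 * b 0 - a 0 * b 2, a 0 * b 1 - a 1 * b 0]

/-- `Ωv = (Ω_{23}v, −Ω_{13}v, Ω_{12}v)`. -/
def OmegaVec (v : Fn) (t : ℝ) (x : E3) : Fin 3 → ℝ :=
  ![rotA 1 2 v t x, -(rotA 0 2 v t x), rotA 0 1 v t x]

/-- `∂^α` for a multi-index with `|α| ≤ 1`: either the identity or a single `∂_a`. -/
def Dle1 : Option (Fin 4) → Fn → Fn
  | none => id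
  | some a => pda a

/-- A linear combination, with constant real coefficients, of the null forms
`Q_0(u_j, ∂^α u_k; c)` and `Q_{ab}(u_j, ∂^α u_k)` with `0 ≤ a < b ≤ 3`, `|α| ≤ 1`. -/
def NullF (c : ℝ) (m : ℕ)
    (a0 : Fin m → Fin m → Fin m → Option (Fin 4) → ℝ)
    (aQ : Fin m → Fin m → Fin m → Fin 4 → Fin 4 → Option (Fin 4) → ℝ)
    (v : Fin m → Fn) (i : Fin m) : Fn := fun t x =>
  (∑ j, ∑ k, ∑ o : Option (Fin 4), a0 i j k o * Q0f c (v j) (Dle1 o (v k)) t x) +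
    ∑ j, ∑ k, ∑ p ∈ Finset.univ.filter (fun p : Fin 4 × Fin 4 => p.1 < p.2),
      ∑ o : Option (Fin 4), aQ i j k p.1 p.2 o * Qab p.1 p.2 (v j) (Dle1 o (v k)) t x

/-- Off the origin the unit radial vector satisfies `∑ ω_j² = 1`. -/
theorem sum_sq_div_norm (x : E3) (hx : x ≠ 0) :
    (x 0 / ‖x‖) ^ 2 + (x 1 / ‖x‖) ^ 2 + (x 2 / ‖x‖) ^ 2 = 1 := by
  have hr : ‖x‖ ≠ 0 := norm_ne_zero_iff.mpr hx
  have hs : ‖x‖ ^ 2 = x 0 ^ 2 + x 1 ^ 2 + x 2 ^ 2 := by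
    rw [EuclideanSpace.real_norm_sq_eq, Fin.sum_univ_three]
  field_simp
  exact hs.symm

/-- The rotation field divided by `r`, in terms of the unit radial vector. -/
theorem rotA_div_norm (j k : Fin 3) (f : Fn) (t : ℝ) (x : E3) :
    rotA j k f t x / ‖x‖ = x j / ‖x‖ * pd k f t x - x k / ‖x‖ * pd j f t x := by
  simp only [rotA]
  ring

theorem stmt7 (c : ℝ) (hc : 0 < c) (v w : Fn) (hv : Smooth v) (hw : Smooth w)
    (t : ℝ) (ht : 0 < t) (x : E3) (hx : x ≠ 0) :
    Q0f c v w t x =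
      (1 / 2) * (Dp c v t x * Dm c w t x + Dm c v t x * Dp c w t x) +
        (c ^ 2 / ‖x‖) * ∑ p ∈ Finset.univ.filter (fun p : Fin 3 × Fin 3 => p.1 ≠ p.2),
          (x p.2 / ‖x‖) * (pd p.1 v t x * rotA p.1 p.2 w t x) := by
  have hω := sum_sq_div_norm x hx
  have hrot : (c ^ 2 / ‖x‖) * ∑ p ∈ Finset.univ.filter (fun p : Fin 3 × Fin 3 => p.1 ≠ p.2),
        (x p.2 / ‖x‖) * (pd p.1 v t x * rotA p.1 p.2 w t x) =
      c ^ 2 * ∑ j, ∑ k, (x k / ‖x‖) *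
        (pd j v t x * (x j / ‖x‖ * pd k w t x - x k / ‖x‖ * pd j w t x)) := by
    rw [← Fintype.sum_prod_type', Finset.sum_filter_of_ne, Finset.mul_sum, Finset.mul_sum]
    · refine Finset.sum_congr rfl fun p _ => ?_
      rw [← rotA_div_norm]
      ring
    · rintro ⟨j, k⟩ _ h hjk
      obtain rfl : j = k := hjk
      simp [rotA] at h
  rw [hrot]
  simp only [Q0f, Dp, Dm, pr, Fin.sum_univ_three]
  linear_combination (c ^ 2 * (pd 0 v t x * pd 0 w t x + pd 1 v t x * pd 1 w t x +
    pd 2 v t x * pd 2 w t x)) * hω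

end PaperKatayama
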